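/- arXiv:2402.16643 — 5 statements merged into one kernel-verified Lean document; each statement's English description precedes it below -/
import Mathlib

section
/- Let q be a prime power and k ≥ 2. For every function M from the set of points of PG(k−1,q) to ℚ (extended additively to subspaces by M(S) := Σ_{P point, P ⊆ S} M(P)) and for every point P, one has M(P) = Σ_{H hyperplane, P ⊆ H} (1/[k−1]_q)·M(H) + Σ_{H hyperplane, P ⊄ H} (1/q^{k−1})·(1/[k−1]_q − 1)·M(H). -/
/-- The points of `PG(k-1,q)`: the 1-dimensional `F`-subspaces of `F^k`. -/
abbrev ProjPoint (F : Type) [Field F] (k : ℕ) : Type :=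
  {P : Submodule F (Fin k → F) // Module.finrank F P = 1}

/-- The hyperplanes of `PG(k-1,q)`: the `(k-1)`-dimensional `F`-subspaces of `F^k`. -/
abbrev ProjHyp (F : Type) [Field F] (k : ℕ) : Type :=
  {H : Submodule F (Fin k → F) // Module.finrank F H = k - 1}

/-- Additive extension of a function on points to subspaces:
`msum M S = Σ_{P point, P ⊆ S} M P`. -/
noncomputable def msum {F : Type} [Field F] {k : ℕ} {R : Type} [AddCommMonoid R]
    (M : ProjPoint F k → R) (S : Submodule F (Fin k → F)) : R :=
  ∑ᶠ (P : ProjPoint F k) (_ : P.1 ≤ S), M P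

/-- The Gaussian number `[m]_q = (q^m - 1)/(q - 1)`. -/
def gaussNum (q m : ℕ) : ℕ := (q ^ m - 1) / (q - 1)

open Module in
/-- The subspaces of codimension one containing `W` correspond to the points of the projective
space of the dual annihilator of `W`. -/
noncomputable def hyperplanesGeEquiv {F : Type} [Field F] {k : ℕ} (hk : 1 ≤ k)
    (W : Submodule F (Fin k → F)) :
    {H : ProjHyp F k // W ≤ H.1} ≃ Projectivization F W.dualAnnihilator :=
  have hrank (H : Submodule F (Fin k → F)) :
      finrank F H = k - 1 ↔ finrank F H.dualAnnihilator = 1 := by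
    have := Subspace.finrank_add_finrank_dualAnnihilator_eq H
    rw [finrank_fin_fun] at this
    omega
  let e₁ : {H : ProjHyp F k // W ≤ H.1} ≃
      {D : Submodule F (Dual F (Fin k → F)) // D ≤ W.dualAnnihilator ∧ finrank F D = 1} :=
    (Equiv.subtypeSubtypeEquivSubtypeInter _ (fun H => W ≤ H)).trans <|
      (Subspace.orderIsoFiniteDimensional.toEquiv.trans OrderDual.ofDual).subtypeEquiv fun H =>
        show finrank F H = k - 1 ∧ W ≤ H ↔
            H.dualAnnihilator ≤ W.dualAnnihilator ∧ finrank F H.dualAnnihilator = 1 by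
          rw [hrank, Subspace.dualAnnihilator_le_dualAnnihilator_iff, and_comm]
  let e₂ : {D : Submodule F W.dualAnnihilator // finrank F D = 1} ≃
      {D : Submodule F (Dual F (Fin k → F)) // D ≤ W.dualAnnihilator ∧ finrank F D = 1} :=
    ((Submodule.mapIic W.dualAnnihilator).toEquiv.subtypeEquiv fun D =>
        show finrank F D = 1 ↔ finrank F (D.map W.dualAnnihilator.subtype) = 1 by
          rw [Submodule.finrank_map_subtype_eq]).trans <|
      Equiv.subtypeSubtypeEquivSubtypeInter (fun D => D ≤ W.dualAnnihilator)
        (fun D => finrank F D = 1)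
  e₁.trans (e₂.symm.trans (Projectivization.equivSubmodule F W.dualAnnihilator).symm)

open Module in
lemma card_hyperplanes_ge {F : Type} [Field F] [Fintype F] {k : ℕ} (hk : 1 ≤ k)
    (W : Submodule F (Fin k → F)) :
    Nat.card {H : ProjHyp F k // W ≤ H.1} = gaussNum (Fintype.card F) (k - finrank F W) := by
  have hW := Subspace.finrank_add_finrank_dualAnnihilator_eq W
  rw [finrank_fin_fun] at hW
  rw [Nat.card_congr (hyperplanesGeEquiv hk W), Projectivization.card'',
    Module.natCard_eq_pow_finrank (K := F), gaussNum, Nat.card_eq_fintype_card,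
    Nat.eq_sub_of_add_eq' hW]

lemma sum_hyperplanes_ge_one {F : Type} [Field F] [Fintype F] {k : ℕ}
    [Fintype (ProjHyp F (k + 2))] (W : Submodule F (Fin (k + 2) → F))
    [DecidablePred fun H : ProjHyp F (k + 2) => W ≤ H.1] :
    ∑ H : ProjHyp F (k + 2), (if W ≤ H.1 then (1 : ℚ) else 0) =
      gaussNum (Fintype.card F) (k + 2 - Module.finrank F W) := by
  rw [Finset.sum_boole, ← card_hyperplanes_ge (by omega) W, Nat.card_eq_fintype_card,
    Fintype.card_subtype]

lemma finrank_sup_eq_two {F : Type} [Field F] {k : ℕ} {P Q : ProjPoint F k} (h : P ≠ Q) :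
    Module.finrank F ↥(P.1 ⊔ Q.1) = 2 := by
  have hadd := Submodule.finrank_sup_add_finrank_inf_eq P.1 Q.1
  have hinf : Module.finrank F ↥(P.1 ⊓ Q.1) < 1 := by
    refine lt_of_le_of_ne ((Submodule.finrank_mono inf_le_left).trans_eq P.2) fun h1 => h ?_
    refine Subtype.ext ?_
    rw [← Submodule.eq_of_le_of_finrank_eq inf_le_left (h1.trans P.2.symm),
      Submodule.eq_of_le_of_finrank_eq inf_le_right (h1.trans Q.2.symm)]
  rw [P.2, Q.2] at hadd
  omega

lemma gaussNum_eq_sum {q : ℕ} (hq : 1 < q) (m : ℕ) :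
    gaussNum q m = ∑ i ∈ Finset.range m, q ^ i :=
  (Nat.geomSum_eq hq m).symm

lemma gaussNum_succ {q : ℕ} (hq : 1 < q) (m : ℕ) : gaussNum q (m + 1) = q * gaussNum q m + 1 := by
  rw [gaussNum_eq_sum hq, gaussNum_eq_sum hq, geom_sum_succ]

lemma gaussNum_succ' {q : ℕ} (hq : 1 < q) (m : ℕ) :
    gaussNum q (m + 1) = gaussNum q m + q ^ m := by
  rw [gaussNum_eq_sum hq, gaussNum_eq_sum hq, Finset.sum_range_succ]

/-- reconstruction of point multiplicities from hyperplane multiplicities. -/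
theorem reconstruct_points_from_hyperplanes
    (F : Type) [Field F] [Fintype F] (k : ℕ) (hk : 2 ≤ k)
    (M : ProjPoint F k → ℚ) (P : ProjPoint F k) :
    M P =
      (∑ᶠ (H : ProjHyp F k) (_ : P.1 ≤ H.1),
        (1 / (gaussNum (Fintype.card F) (k - 1) : ℚ)) * msum M H.1) +
      (∑ᶠ (H : ProjHyp F k) (_ : ¬ P.1 ≤ H.1),
        (1 / (Fintype.card F : ℚ) ^ (k - 1)) *
          ((1 / (gaussNum (Fintype.card F) (k - 1) : ℚ)) - 1) * msum M H.1) := by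
  classical
  have : Fintype (ProjPoint F k) := Fintype.ofFinite _
  have : Fintype (ProjHyp F k) := Fintype.ofFinite _
  obtain ⟨n, rfl⟩ : ∃ n, k = n + 2 := ⟨k - 2, by omega⟩
  have hg : gaussNum (Fintype.card F) (n + 1) = Fintype.card F * gaussNum (Fintype.card F) n + 1 :=
    gaussNum_succ Fintype.one_lt_card n
  have hp : gaussNum (Fintype.card F) (n + 1) =
      gaussNum (Fintype.card F) n + Fintype.card F ^ n :=
    gaussNum_succ' Fintype.one_lt_card n
  have hq : (Fintype.card F : ℚ) ≠ 0 := by exact_mod_cast Fintype.card_ne_zero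
  have hone (Q : ProjPoint F (n + 2)) :
      ∑ H : ProjHyp F (n + 2), (if Q.1 ≤ H.1 then (1 : ℚ) else 0) =
        gaussNum (Fintype.card F) (n + 1) := by
    rw [sum_hyperplanes_ge_one, Q.2]; rfl
  have htwo (Q : ProjPoint F (n + 2)) (hQ : P ≠ Q) :
      ∑ H : ProjHyp F (n + 2), (if P.1 ⊔ Q.1 ≤ H.1 then (1 : ℚ) else 0) =
        gaussNum (Fintype.card F) n := by
    rw [sum_hyperplanes_ge_one, finrank_sup_eq_two hQ]; rfl
  simp only [finsum_eq_sum_of_fintype, finsum_eq_if, msum, Nat.add_succ_sub_one]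
  set q : ℚ := (Fintype.card F : ℚ)
  set g : ℚ := (gaussNum (Fintype.card F) (n + 1) : ℚ) with hgdef
  set b : ℚ := 1 / q ^ (n + 1) * (1 / g - 1) with hb
  have hg' : g = q * gaussNum (Fintype.card F) n + 1 := by rw [hgdef, hg]; push_cast; rfl
  have hp' : g = gaussNum (Fintype.card F) n + q ^ n := by rw [hgdef, hp]; push_cast; rfl
  have hg0 : g ≠ 0 := by rw [hg']; positivity
  have hterm (H : ProjHyp F (n + 2)) :
      (if P.1 ≤ H.1 then 1 / g * ∑ Q, (if Q.1 ≤ H.1 then M Q else 0) else 0) +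
        (if ¬ P.1 ≤ H.1 then b * ∑ Q, (if Q.1 ≤ H.1 then M Q else 0) else 0) =
      ∑ Q, ((1 / g - b) * (if P.1 ⊔ Q.1 ≤ H.1 then 1 else 0) +
        b * (if Q.1 ≤ H.1 then 1 else 0)) * M Q := by
    by_cases hP : P.1 ≤ H.1
    · simp only [hP, not_true, if_true, if_false, add_zero, Finset.mul_sum, sup_le_iff, true_and]
      refine Finset.sum_congr rfl fun Q _ => ?_
      split_ifs <;> ring
    · simp only [hP, not_false_iff, if_true, if_false, zero_add, Finset.mul_sum, sup_le_iff,
        false_and]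
      refine Finset.sum_congr rfl fun Q _ => ?_
      split_ifs <;> ring
  rw [← Finset.sum_add_distrib, Finset.sum_congr rfl fun H _ => hterm H, Finset.sum_comm]
  simp only [← Finset.sum_mul, Finset.sum_add_distrib, ← Finset.mul_sum, hone]
  rw [Finset.sum_eq_single P]
  · rw [sup_idem, hone]
    field_simp
    ring
  · intro Q _ hQ
    rw [htwo Q hQ.symm, hb]
    suffices h : (1 / g - 1 / q ^ (n + 1) * (1 / g - 1)) * (gaussNum (Fintype.card F) n : ℚ) +
        1 / q ^ (n + 1) * (1 / g - 1) * g = 0 by rw [h, zero_mul]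
    set x : ℚ := (gaussNum (Fintype.card F) n : ℚ)
    have hqn : q ^ n = g - x := by linear_combination -hp'
    have hgx : g - x ≠ 0 := hqn ▸ pow_ne_zero n hq
    rw [pow_succ, hqn]
    field_simp
    linear_combination (x - g) * hg'
  · simp
end

section
/- Let q be a prime power and k ≥ 2. For every function F from the set of points of PG(k−1,q) to ℚ there exist rational coefficients α_H, one for each hyperplane H of PG(k−1,q), such that F(P) = Σ_{H hyperplane} α_H·χ_H(P) for every point P, and the coefficients α_H are uniquely determined by F. In other words, the family (χ_H)_{H hyperplane} is a basis of the ℚ-vector space of all functions from points of PG(k−1,q) to ℚ. -/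
open Classical in
/-- The number of vectors of a subspace, as a sum of indicator values. -/
lemma sum_indicator_submodule_eq_pow {F V : Type*} [Field F] [Fintype F] [AddCommGroup V]
    [Module F V] [Fintype V] (W : Submodule F V) :
    ∑ v : V, (if v ∈ W then (1 : ℚ) else 0) =
      (Fintype.card F : ℚ) ^ Module.finrank F W := by
  have h := Module.card_eq_pow_finrank (K := F) (V := W)
  rw [Finset.sum_boole, ← Fintype.card_subtype]
  exact_mod_cast h

/-- Two distinct hyperplanes meet in a subspace of codimension two. -/
lemma ProjHyp.finrank_inf {F : Type} [Field F] {k : ℕ} (hk : 2 ≤ k)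
    {H H' : ProjHyp F k} (hne : H ≠ H') :
    Module.finrank F (H.1 ⊓ H'.1 : Submodule F (Fin k → F)) = k - 2 := by
  have hsum := Submodule.finrank_sup_add_finrank_inf_eq H.1 H'.1
  have hle : Module.finrank F (H.1 ⊔ H'.1 : Submodule F (Fin k → F)) ≤ k := by
    simpa using Submodule.finrank_le (H.1 ⊔ H'.1)
  have hlt : k - 1 < Module.finrank F (H.1 ⊔ H'.1 : Submodule F (Fin k → F)) := by
    refine H.2.symm.trans_lt (Submodule.finrank_lt_finrank_of_lt ?_)
    refine lt_of_le_of_ne le_sup_left fun h => hne (Subtype.ext ?_)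
    have hle' : H'.1 ≤ H.1 := h ▸ le_sup_right
    exact (Submodule.eq_of_le_of_finrank_eq hle' (H'.2.trans H.2.symm)).symm
  rw [H.2, H'.2] at hsum
  omega

/-- The orthogonal complement for the dot product is a duality between points and
hyperplanes. -/
lemma card_projPoint_eq_card_projHyp (F : Type) [Field F] (k : ℕ) (hk : 2 ≤ k) :
    Nat.card (ProjPoint F k) = Nat.card (ProjHyp F k) := by
  let B : LinearMap.BilinForm F (Fin k → F) := dotProductBilin F F
  have hrefl : B.IsRefl := fun x y h => (dotProduct_comm y x).trans h
  have hB : B.Nondegenerate :=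
    hrefl.nondegenerate_iff_separatingLeft.mpr fun x hx => dotProduct_eq_zero x hx
  have hfin (W : Submodule F (Fin k → F)) :
      Module.finrank F (B.orthogonal W) = k - Module.finrank F W := by
    simpa using LinearMap.BilinForm.finrank_orthogonal hB W
  exact Nat.card_congr
    { toFun := fun P => ⟨B.orthogonal P.1, by rw [hfin, P.2]⟩
      invFun := fun H => ⟨B.orthogonal H.1, by rw [hfin, H.2]; omega⟩
      left_inv := fun P => Subtype.ext (LinearMap.BilinForm.orthogonal_orthogonal hB hrefl P.1)
      right_inv := fun H => Subtype.ext (LinearMap.BilinForm.orthogonal_orthogonal hB hrefl H.1) }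

open Classical in
/-- The linear map sending coefficients `α` to the function `P ↦ ∑ H, α H * χ_H P`. -/
noncomputable def incidenceMap (F : Type) [Field F] [Fintype F] (k : ℕ) :
    (ProjHyp F k → ℚ) →ₗ[ℚ] (ProjPoint F k → ℚ) where
  toFun α P := ∑ H : ProjHyp F k, if P.1 ≤ H.1 then α H else 0
  map_add' α β := by
    ext P
    simp only [Pi.add_apply, ← Finset.sum_add_distrib]
    exact Finset.sum_congr rfl fun H _ => by split_ifs <;> simp
  map_smul' c α := by
    ext P
    simp [Finset.mul_sum]

lemma incidenceMap_apply {F : Type} [Field F] [Fintype F] {k : ℕ} (α : ProjHyp F k → ℚ)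
    (P : ProjPoint F k) :
    incidenceMap F k α P = ∑ᶠ (H : ProjHyp F k) (_ : P.1 ≤ H.1), α H := by
  classical
  rw [finsum_eq_sum_of_fintype]
  exact Finset.sum_congr rfl fun H _ => by rw [finsum_eq_if]

open Classical in
/-- If `α` is in the kernel of the incidence map, counting vectors of a hyperplane `H` gives a
linear equation relating `α H` to the sum of all coefficients. -/
lemma ProjHyp.coeff_eq_of_incidenceMap_eq_zero {F : Type} [Field F] [Fintype F] {k : ℕ}
    (hk : 2 ≤ k) {α : ProjHyp F k → ℚ} (hα : incidenceMap F k α = 0) (H : ProjHyp F k) :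
    ((Fintype.card F : ℚ) ^ (k - 1) - (Fintype.card F : ℚ) ^ (k - 2)) * α H +
      (Fintype.card F : ℚ) ^ (k - 2) * ∑ H', α H' = ∑ H', α H' := by
  have hvec (v : Fin k → F) (hv : v ≠ 0) :
      ∑ H' : ProjHyp F k, (if v ∈ H'.1 then α H' else 0) = 0 := by
    have h := congrFun hα ⟨F ∙ v, finrank_span_singleton hv⟩
    simpa [incidenceMap, Submodule.span_singleton_le_iff_mem] using h
  have hleft : ∑ v : Fin k → F, ∑ H' : ProjHyp F k,
      (if v ∈ H.1 ⊓ H'.1 then α H' else 0) = ∑ H', α H' := by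
    rw [Finset.sum_eq_single 0]
    · simp
    · intro v _ hv
      by_cases hvH : v ∈ H.1
      · simpa [hvH] using hvec v hv
      · simp [hvH]
    · simp
  have hright (H' : ProjHyp F k) : ∑ v : Fin k → F, (if v ∈ H.1 ⊓ H'.1 then α H' else 0) =
      (Fintype.card F : ℚ) ^ (k - 2) * α H' + if H = H' then
        ((Fintype.card F : ℚ) ^ (k - 1) - (Fintype.card F : ℚ) ^ (k - 2)) * α H' else 0 := by
    have h := sum_indicator_submodule_eq_pow (H.1 ⊓ H'.1)
    have hmul : ∑ v : Fin k → F, (if v ∈ H.1 ⊓ H'.1 then α H' else 0) =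
        (∑ v : Fin k → F, if v ∈ H.1 ⊓ H'.1 then (1 : ℚ) else 0) * α H' := by
      simp only [Finset.sum_mul, ite_mul, one_mul, zero_mul]
    rw [hmul, h]
    split_ifs with hHH
    · subst hHH
      rw [inf_idem, H.2]
      ring
    · rw [ProjHyp.finrank_inf hk hHH, add_zero]
  rw [Finset.sum_comm, Finset.sum_congr rfl fun H' _ => hright H', Finset.sum_add_distrib,
    ← Finset.mul_sum, Finset.sum_ite_eq, if_pos (Finset.mem_univ H)] at hleft
  linarith

lemma incidenceMap_injective (F : Type) [Field F] [Fintype F] (k : ℕ) (hk : 2 ≤ k) :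
    Function.Injective (incidenceMap F k) := by
  classical
  rw [injective_iff_map_eq_zero]
  intro α hα
  have hcoeff := ProjHyp.coeff_eq_of_incidenceMap_eq_zero hk hα
  set q : ℚ := (Fintype.card F : ℚ) with hq
  set S : ℚ := ∑ H, α H with hS
  have hq1 : 1 < q := by
    rw [hq]
    exact_mod_cast Fintype.one_lt_card
  have hpow : 1 ≤ q ^ (k - 2) := one_le_pow₀ hq1.le
  have hpos : 0 < q ^ (k - 1) - q ^ (k - 2) :=
    sub_pos.mpr (pow_lt_pow_right₀ hq1 (by omega))
  have hsum : (q ^ (k - 1) - q ^ (k - 2)) * S +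
      Fintype.card (ProjHyp F k) * ((q ^ (k - 2) - 1) * S) = 0 := by
    have h : ∑ H, ((q ^ (k - 1) - q ^ (k - 2)) * α H + (q ^ (k - 2) - 1) * S) = 0 :=
      Finset.sum_eq_zero fun H _ => by linarith [hcoeff H]
    simpa [Finset.sum_add_distrib, ← Finset.mul_sum, ← hS] using h
  have hfactor : 0 < (q ^ (k - 1) - q ^ (k - 2)) +
      Fintype.card (ProjHyp F k) * (q ^ (k - 2) - 1) :=
    add_pos_of_pos_of_nonneg hpos (mul_nonneg (Nat.cast_nonneg _) (sub_nonneg.mpr hpow))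
  have hS0 : S = 0 := by
    refine (mul_eq_zero.mp ?_).resolve_left hfactor.ne'
    linarith
  ext H
  have h := hcoeff H
  rw [hS0, mul_zero, add_zero] at h
  exact (mul_eq_zero.mp h).resolve_left hpos.ne'

/-- the characteristic functions of hyperplanes form a basis of the
`ℚ`-vector space of functions on points: every function has a unique representation
`F(P) = Σ_H α_H · χ_H(P)`. -/
theorem hyperplane_characteristic_functions_basis
    (F : Type) [Field F] [Fintype F] (k : ℕ) (hk : 2 ≤ k)
    (Fn : ProjPoint F k → ℚ) :
    ∃! α : ProjHyp F k → ℚ,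
      ∀ P : ProjPoint F k, Fn P = ∑ᶠ (H : ProjHyp F k) (_ : P.1 ≤ H.1), α H := by
  have hcard : Module.finrank ℚ (ProjHyp F k → ℚ) = Module.finrank ℚ (ProjPoint F k → ℚ) := by
    rw [Module.finrank_pi, Module.finrank_pi, ← Nat.card_eq_fintype_card,
      ← Nat.card_eq_fintype_card, card_projPoint_eq_card_projHyp F k hk]
  have hinj := incidenceMap_injective F k hk
  have hbij : Function.Bijective (incidenceMap F k) :=
    ⟨hinj, (LinearMap.injective_iff_surjective_of_finrank_eq_finrank hcard).mp hinj⟩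
  simpa only [funext_iff, incidenceMap_apply, eq_comm] using hbij.existsUnique Fn
end

section
/- Let q be a prime power, k ≥ 3, let ℋ' be a set of hyperplanes of PG(k−1,q), and let M be a multiset of points such that M(H) = s for every H ∈ ℋ' and M(H) = t for every hyperplane H ∉ ℋ', where s, t ∈ ℕ. Set r := #ℋ', Δ := s − t ∈ ℤ, and for every point P let φ(P) := #{H ∈ ℋ' : P ⊆ H}. Then for every point P, as an identity in ℚ, M(P) = (t + Δ·φ(P))/[k−1]_q − (Δ/q^{k−2})·([k−2]_q/[k−1]_q)·(r − φ(P)). -/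
open scoped Classical in
/-- The nonzero functionals vanishing on `W` number `q ^ (k - dim W) - 1`. -/
lemma card_nonzero_annihilating (F : Type) [Field F] [Fintype F] (k : ℕ)
    [Fintype (Module.Dual F (Fin k → F))] (W : Submodule F (Fin k → F)) :
    (Finset.univ.filter fun f : Module.Dual F (Fin k → F) =>
        f ≠ 0 ∧ W ≤ LinearMap.ker f).card + 1 =
      Fintype.card F ^ (k - Module.finrank F W) := by
  have hdim := Subspace.finrank_add_finrank_dualAnnihilator_eq W
  rw [Module.finrank_fin_fun] at hdim
  rw [show k - Module.finrank F W = Module.finrank F W.dualAnnihilator by omega,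
    ← Module.card_eq_pow_finrank (K := F) (V := W.dualAnnihilator), Fintype.card_subtype,
    ← Finset.card_erase_add_one (s := Finset.univ.filter (· ∈ W.dualAnnihilator)) (a := 0)
      (by simp)]
  congr 2
  ext f
  simp [Submodule.mem_dualAnnihilator, SetLike.le_def]

/-- A nonzero functional vanishing on a hyperplane has that hyperplane as its kernel. -/
lemma le_ker_iff_ker_eq {F : Type} [Field F] {k : ℕ} (H : ProjHyp F k)
    {f : Module.Dual F (Fin k → F)} (hf : f ≠ 0) :
    H.1 ≤ LinearMap.ker f ↔ LinearMap.ker f = H.1 := by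
  refine ⟨fun h => (Submodule.eq_of_le_of_finrank_eq h ?_).symm, fun h => h.ge⟩
  have := Module.Dual.finrank_ker_add_one_of_ne_zero hf
  rw [Module.finrank_fin_fun] at this
  rw [H.2]
  omega

open scoped Classical in
/-- The hyperplanes through a subspace `W` number `(q ^ (k - dim W) - 1) / (q - 1)`. -/
lemma card_hyperplanes_through (F : Type) [Field F] [Fintype F] (k : ℕ) (hk : 1 ≤ k)
    [Fintype (ProjHyp F k)] (W : Submodule F (Fin k → F)) :
    (Finset.univ.filter fun H : ProjHyp F k => W ≤ H.1).card =
      gaussNum (Fintype.card F) (k - Module.finrank F W) := by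
  have : Finite (Module.Dual F (Fin k → F)) := Module.finite_of_finite F
  have := Fintype.ofFinite (Module.Dual F (Fin k → F))
  have hq : 1 < Fintype.card F := Fintype.one_lt_card
  have hfib (H : ProjHyp F k) : (Finset.univ.filter fun f : Module.Dual F (Fin k → F) =>
      f ≠ 0 ∧ LinearMap.ker f = H.1).card = Fintype.card F - 1 := by
    have h := card_nonzero_annihilating F k H.1
    rw [H.2, Nat.sub_sub_self hk, pow_one] at h
    rw [← h, Nat.add_sub_cancel]
    congr 1
    ext f
    simp +contextual [le_ker_iff_ker_eq H]
  have hcount : (Finset.univ.filter fun f : Module.Dual F (Fin k → F) =>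
      f ≠ 0 ∧ W ≤ LinearMap.ker f).card =
      (Finset.univ.filter fun H : ProjHyp F k => W ≤ H.1).card * (Fintype.card F - 1) := by
    rw [← smul_eq_mul, ← Finset.sum_const, ← Finset.sum_congr rfl fun H _ => hfib H,
      ← Finset.card_biUnion]
    · congr 1
      ext f
      simp only [Finset.mem_filter, Finset.mem_univ, true_and, Finset.mem_biUnion]
      constructor
      · rintro ⟨hf, hW⟩
        have := Module.Dual.finrank_ker_add_one_of_ne_zero hf
        rw [Module.finrank_fin_fun] at this
        exact ⟨⟨LinearMap.ker f, by omega⟩, hW, hf, rfl⟩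
      · rintro ⟨H, hW, hf, hH⟩
        exact ⟨hf, hH ▸ hW⟩
    · intro H _ H' _ hne
      refine Finset.disjoint_left.mpr fun f hf hf' => hne (Subtype.ext ?_)
      simp only [Finset.mem_filter] at hf hf'
      exact hf.2.2.symm.trans hf'.2.2
  have h := card_nonzero_annihilating F k W
  rw [gaussNum, ← h, Nat.add_sub_cancel, hcount, Nat.mul_div_cancel _ (by omega)]

lemma gaussNum_mul_pred {q : ℕ} (hq : 1 < q) (m : ℕ) :
    (gaussNum q m : ℚ) * ((q : ℚ) - 1) = (q : ℚ) ^ m - 1 := by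
  rw [gaussNum, ← Nat.geomSum_eq hq]
  push_cast
  exact geom_sum_mul _ _

open scoped Classical in
lemma msum_eq_sum {F : Type} [Field F] {k : ℕ} {R : Type} [AddCommMonoid R]
    [Fintype (ProjPoint F k)] (M : ProjPoint F k → R) (S : Submodule F (Fin k → F)) :
    msum M S = ∑ P : ProjPoint F k, if P.1 ≤ S then M P else 0 := by
  simp only [msum, finsum_eq_if, finsum_eq_sum_of_fintype]

/-- The span of two distinct points is a line. -/
lemma finrank_sup_of_ne {F : Type} [Field F] {k : ℕ} {P Q : ProjPoint F k} (h : P ≠ Q) :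
    Module.finrank F (P.1 ⊔ Q.1 : Submodule F (Fin k → F)) = 2 := by
  have hsum := Submodule.finrank_sup_add_finrank_inf_eq P.1 Q.1
  have hinf : Module.finrank F (P.1 ⊓ Q.1 : Submodule F (Fin k → F)) ≠ 1 := fun h1 => by
    have hP := Submodule.eq_of_le_of_finrank_eq (inf_le_left : P.1 ⊓ Q.1 ≤ P.1) (h1.trans P.2.symm)
    have hQ := Submodule.eq_of_le_of_finrank_eq (inf_le_right : P.1 ⊓ Q.1 ≤ Q.1) (h1.trans Q.2.symm)
    exact h (Subtype.ext (hP.symm.trans hQ))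
  have hle := Submodule.finrank_mono (inf_le_left : P.1 ⊓ Q.1 ≤ P.1)
  have hP := P.2
  have hQ := Q.2
  omega

open scoped Classical in
/-- Double counting of incidences between points and the hyperplanes through `W`. -/
lemma sum_msum_hyperplanes_through (F : Type) [Field F] [Fintype F] (k : ℕ) (hk : 1 ≤ k)
    [Fintype (ProjHyp F k)] [Fintype (ProjPoint F k)] (M : ProjPoint F k → ℕ)
    (W : Submodule F (Fin k → F)) :
    ∑ H : ProjHyp F k with W ≤ H.1, msum M H.1 =
      ∑ Q : ProjPoint F k,
        gaussNum (Fintype.card F) (k - Module.finrank F (W ⊔ Q.1 : Submodule F (Fin k → F))) *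
          M Q := by
  simp only [msum_eq_sum]
  rw [Finset.sum_comm]
  refine Finset.sum_congr rfl fun Q _ => ?_
  rw [← Finset.sum_filter, Finset.sum_const, smul_eq_mul, Finset.filter_filter,
    ← card_hyperplanes_through F k hk]
  simp only [sup_le_iff]

open scoped Classical in
/-- The sum of the hyperplane multiplicities over the hyperplanes through `W`, for a multiset
with multiplicity `s` on `Hs` and `t` elsewhere. -/
lemma sum_msum_two_values (F : Type) [Field F] [Fintype F] (k : ℕ) (hk : 1 ≤ k)
    [Fintype (ProjHyp F k)] (Hs : Set (ProjHyp F k)) (M : ProjPoint F k → ℕ) (s t : ℕ)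
    (hs : ∀ H ∈ Hs, msum M H.1 = s)
    (ht : ∀ H : ProjHyp F k, H ∉ Hs → msum M H.1 = t) (W : Submodule F (Fin k → F)) :
    ((∑ H : ProjHyp F k with W ≤ H.1, msum M H.1 : ℕ) : ℚ) =
      (t : ℚ) * gaussNum (Fintype.card F) (k - Module.finrank F W) +
        ((s : ℚ) - t) * ({H ∈ Hs | W ≤ H.1}.ncard : ℚ) := by
  have hM (H : ProjHyp F k) :
      ((msum M H.1 : ℕ) : ℚ) = t + if H ∈ Hs then (s : ℚ) - t else 0 := by
    split_ifs with h
    · rw [hs H h]; ring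
    · rw [ht H h]; ring
  push_cast
  simp only [hM]
  rw [Finset.sum_add_distrib, Finset.sum_const, card_hyperplanes_through F k hk,
    ← Finset.sum_filter, Finset.sum_const, Finset.filter_filter, nsmul_eq_mul, nsmul_eq_mul,
    mul_comm, mul_comm (Finset.card _ : ℚ), Set.ncard_eq_toFinset_card']
  congr 4
  ext H
  simp [and_comm]

/-- explicit formula for the point multiplicities of a multiset whose
hyperplane multiplicity is `s` on the hyperplanes of `ℋ'` and `t` elsewhere:
`M(P) = (t + Δ·φ(P))/[k-1]_q − (Δ/q^{k-2})·([k-2]_q/[k-1]_q)·(r − φ(P))` in `ℚ`,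
where `Δ = s − t`, `r = #ℋ'` and `φ(P) = #{H ∈ ℋ' : P ⊆ H}`. -/
theorem point_multiplicity_formula
    (F : Type) [Field F] [Fintype F] (k : ℕ) (hk : 3 ≤ k)
    (Hs : Set (ProjHyp F k)) (M : ProjPoint F k → ℕ) (s t : ℕ)
    (hs : ∀ H ∈ Hs, msum M H.1 = s)
    (ht : ∀ H : ProjHyp F k, H ∉ Hs → msum M H.1 = t)
    (P : ProjPoint F k) :
    (M P : ℚ) =
      ((t : ℚ) + ((s : ℚ) - (t : ℚ)) * ({H ∈ Hs | P.1 ≤ H.1}.ncard : ℚ))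
          / (gaussNum (Fintype.card F) (k - 1) : ℚ)
      - (((s : ℚ) - (t : ℚ)) / (Fintype.card F : ℚ) ^ (k - 2))
          * ((gaussNum (Fintype.card F) (k - 2) : ℚ)
              / (gaussNum (Fintype.card F) (k - 1) : ℚ))
          * ((Hs.ncard : ℚ) - ({H ∈ Hs | P.1 ≤ H.1}.ncard : ℚ)) := by
  classical
  have := Fintype.ofFinite (ProjHyp F k)
  have := Fintype.ofFinite (ProjPoint F k)
  have hk1 : 1 ≤ k := by omega
  have hq : 1 < Fintype.card F := Fintype.one_lt_card
  have hthrough := sum_msum_two_values F k hk1 Hs M s t hs ht P.1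
  have hall := sum_msum_two_values F k hk1 Hs M s t hs ht ⊥
  rw [sum_msum_hyperplanes_through F k hk1] at hthrough hall
  have hpoint (Q : ProjPoint F k) :
      Module.finrank F (⊥ ⊔ Q.1 : Submodule F (Fin k → F)) = 1 := by rw [bot_sup_eq, Q.2]
  simp only [hpoint, bot_le, and_true, Set.ofPred_mem_eq, finrank_bot, Nat.sub_zero,
    ← Finset.mul_sum] at hall
  have hsplit : ∑ Q : ProjPoint F k, gaussNum (Fintype.card F)
      (k - Module.finrank F (P.1 ⊔ Q.1 : Submodule F (Fin k → F))) * M Q +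
        gaussNum (Fintype.card F) (k - 2) * M P =
      gaussNum (Fintype.card F) (k - 1) * M P +
        gaussNum (Fintype.card F) (k - 2) * ∑ Q, M Q := by
    rw [← Finset.add_sum_erase _ _ (Finset.mem_univ P),
      ← Finset.add_sum_erase _ M (Finset.mem_univ P), sup_idem, P.2, mul_add, Finset.mul_sum,
      Finset.sum_congr rfl fun Q hQ => by
        rw [finrank_sup_of_ne (Finset.ne_of_mem_erase hQ).symm]]
    ring
  rw [P.2] at hthrough
  generalize {H ∈ Hs | P.1 ≤ H.1}.ncard = φ at *
  generalize Hs.ncard = r at *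
  replace hsplit := congrArg (Nat.cast : ℕ → ℚ) hsplit
  rw [Nat.cast_add, hthrough] at hsplit
  push_cast at hsplit hall
  obtain ⟨j, rfl⟩ := Nat.exists_eq_add_of_le' (show 2 ≤ k by omega)
  have h0 := gaussNum_mul_pred hq j
  have h1 := gaussNum_mul_pred hq (j + 1)
  have h2 := gaussNum_mul_pred hq (j + 2)
  simp only [Nat.add_sub_cancel, show j + 2 - 1 = j + 1 by omega] at *
  have hq' : (1 : ℚ) < Fintype.card F := by exact_mod_cast hq
  generalize (Fintype.card F : ℚ) = q at *
  have hq1 : q - 1 ≠ 0 := by linarith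
  have hqj : q ^ j ≠ 0 := pow_ne_zero _ (by linarith)
  have hg1 : (gaussNum (Fintype.card F) (j + 1) : ℚ) ≠ 0 := by
    intro h
    have : 1 < q ^ (j + 1) := one_lt_pow₀ hq' (Nat.succ_ne_zero j)
    rw [h, zero_mul] at h1
    linarith
  generalize (gaussNum (Fintype.card F) j : ℚ) = a at *
  generalize (gaussNum (Fintype.card F) (j + 1) : ℚ) = b at *
  generalize (gaussNum (Fintype.card F) (j + 2) : ℚ) = c at *
  have hab : b = a + q ^ j := mul_right_cancel₀ hq1 (by linear_combination h1 - h0)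
  have hbc : b ^ 2 - c * a = q ^ j :=
    mul_right_cancel₀ (pow_ne_zero 2 hq1) (by
      linear_combination (b * (q - 1) + q ^ (j + 1) - 1) * h1 - a * (q - 1) * h2
        - (q ^ (j + 2) - 1) * h0)
  field_simp
  linear_combination (-b) * hsplit - a * hall
    + (((s : ℚ) - t) * φ - b * M P) * hab + t * hbc
end

section
/- Let q = p^e be a prime power with p prime, k ≥ 2, and let M be a multiset of points in PG(k−1,q) with n := #M. Suppose Δ is a power of p and m ∈ ℕ is such that n − M(H) ≡ m (mod Δ) for every hyperplane H (i.e., the corresponding full-length code has all non-zero weights ≡ m (mod Δ)). Then m ≡ 0 (mod min{Δ, q}). Moreover, if q divides Δ, then for every (k−2)-dimensional subspace K of 𝔽_q^k and every hyperplane H with K ⊆ H one has M(H) − M(K) ≡ m/q (mod Δ/q); i.e., the non-zero weights in each residual code are congruent to m/q modulo Δ/q. -/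
/-- The hyperplanes through a subspace of codimension two can be indexed by `Option F` so that
every vector outside the subspace lies in exactly one of them. -/
theorem exists_pencil {F : Type} [Field F] {k : ℕ} (hk : 2 ≤ k)
    (K : Submodule F (Fin k → F)) (hK : Module.finrank F K = k - 2) :
    ∃ H : Option F → ProjHyp F k, (∀ o, K ≤ (H o).1) ∧ ∀ v ∉ K, ∃! o, v ∈ (H o).1 := by
  have hquot : Module.finrank F ((Fin k → F) ⧸ K) = Module.finrank F (Fin 2 → F) := by
    have := K.finrank_quotient_add_finrank
    simp only [Module.finrank_fin_fun] at this ⊢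
    omega
  let φ : (Fin k → F) →ₗ[F] (Fin 2 → F) :=
    (LinearEquiv.ofFinrankEq _ _ hquot).toLinearMap ∘ₗ K.mkQ
  have hφ (v) : φ v = 0 ↔ v ∈ K := by simp [φ]
  have hsurj : Function.Surjective φ :=
    (LinearEquiv.ofFinrankEq _ _ hquot).surjective.comp K.mkQ_surjective
  let f : Option F → Module.Dual F (Fin k → F) := fun o ↦
    o.elim (LinearMap.proj 0 ∘ₗ φ)
      (fun a ↦ LinearMap.proj 1 ∘ₗ φ - a • (LinearMap.proj 0 ∘ₗ φ))
  have hf0 (o) : f o ≠ 0 := by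
    intro h
    rcases o with _ | a
    · obtain ⟨v, hv⟩ := hsurj ![1, 0]
      simpa [f, hv] using LinearMap.congr_fun h v
    · obtain ⟨v, hv⟩ := hsurj ![0, 1]
      simpa [f, hv] using LinearMap.congr_fun h v
  refine ⟨fun o ↦ ⟨(f o).ker, ?_⟩, fun o v hv ↦ ?_, fun v hv ↦ ?_⟩
  · have := Module.Dual.finrank_ker_add_one_of_ne_zero (hf0 o)
    simp only [Module.finrank_fin_fun] at this
    omega
  · have := (hφ v).2 hv
    rcases o with _ | a <;> simp [f, this]
  · have hne : ¬ (φ v 0 = 0 ∧ φ v 1 = 0) := fun h ↦ hv ((hφ v).1 (by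
      ext i; fin_cases i <;> simp [h.1, h.2]))
    by_cases h0 : φ v 0 = 0
    · refine ⟨none, by simpa [f] using h0, ?_⟩
      rintro (_ | a) h
      · rfl
      · exact absurd ⟨h0, by simpa [f, h0] using h⟩ hne
    · refine ⟨some (φ v 1 / φ v 0), by simp [f, h0], ?_⟩
      rintro (_ | a) h
      · exact absurd (by simpa [f] using h) h0
      · have : φ v 1 - a * φ v 0 = 0 := by simpa [f] using h
        rw [Option.some_inj, eq_div_iff h0]
        exact (sub_eq_zero.1 this).symm

theorem msum_mono {F : Type} [Field F] [Finite F] {k : ℕ} (M : ProjPoint F k → ℕ)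
    {S T : Submodule F (Fin k → F)} (h : S ≤ T) : msum M S ≤ msum M T := by
  classical
  have := Fintype.ofFinite (ProjPoint F k)
  simp only [msum, finsum_eq_sum_of_fintype, finsum_eq_if]
  refine Finset.sum_le_sum fun P _ ↦ ?_
  by_cases hS : P.1 ≤ S
  · simp [hS, hS.trans h]
  · simp [hS]

theorem sum_msum_pencil {F : Type} [Field F] [Fintype F] {k : ℕ} (M : ProjPoint F k → ℕ)
    {K : Submodule F (Fin k → F)} {H : Option F → ProjHyp F k} (hKH : ∀ o, K ≤ (H o).1)
    (hH : ∀ v ∉ K, ∃! o, v ∈ (H o).1) :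
    ∑ o, msum M (H o).1 = msum M ⊤ + Fintype.card F * msum M K := by
  classical
  have := Fintype.ofFinite (ProjPoint F k)
  simp only [msum, finsum_eq_sum_of_fintype, finsum_eq_if]
  rw [Finset.sum_comm, Finset.mul_sum, ← Finset.sum_add_distrib]
  refine Finset.sum_congr rfl fun P _ ↦ ?_
  by_cases hPK : P.1 ≤ K
  · simp [hPK, hPK.trans (hKH _)]
    ring
  · obtain ⟨v, -, hv⟩ := finrank_eq_one_iff'.1 P.2
    have hP (S : Submodule F (Fin k → F)) : P.1 ≤ S ↔ (v : Fin k → F) ∈ S := by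
      refine ⟨fun h ↦ h v.2, fun h w hw ↦ ?_⟩
      obtain ⟨c, hc⟩ := hv ⟨w, hw⟩
      have : c • (v : Fin k → F) = w := congrArg Subtype.val hc
      exact this ▸ S.smul_mem c h
    obtain ⟨o, ho, huniq⟩ := hH v (by rwa [← hP])
    have hiff (o') : P.1 ≤ (H o').1 ↔ o' = o :=
      ⟨fun h ↦ huniq o' ((hP _).1 h), fun h ↦ (hP _).2 (h ▸ ho)⟩
    simp [hiff, hPK]

theorem card_mul_msum_sub_modEq {F : Type} [Field F] [Fintype F] {k : ℕ} (hk : 2 ≤ k)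
    (M : ProjPoint F k → ℕ) {Δ m : ℕ}
    (hcong : ∀ H : ProjHyp F k, msum M ⊤ - msum M H.1 ≡ m [MOD Δ])
    (K : Submodule F (Fin k → F)) (hK : Module.finrank F K = k - 2) :
    Fintype.card F * (msum M ⊤ - msum M K) ≡ (Fintype.card F + 1) * m [MOD Δ] := by
  obtain ⟨H, hKH, hH⟩ := exists_pencil hk K hK
  have hsum := sum_msum_pencil M hKH hH
  have hadd : ∑ o, (msum M ⊤ - msum M (H o).1) + ∑ o, msum M (H o).1 =
      (Fintype.card F + 1) * msum M ⊤ := by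
    rw [← Finset.sum_add_distrib,
      Finset.sum_congr rfl fun o _ ↦ Nat.sub_add_cancel (msum_mono M le_top)]
    simp
  have hle : msum M K ≤ msum M ⊤ := msum_mono M le_top
  have heq : Fintype.card F * (msum M ⊤ - msum M K) =
      ∑ o, (msum M ⊤ - msum M (H o).1) := by
    rw [hsum] at hadd
    zify [hle] at hadd ⊢
    linarith
  rw [heq, Nat.ModEq, Finset.sum_nat_mod, Finset.sum_congr rfl fun o _ ↦ hcong (H o),
    ← Finset.sum_nat_mod]
  simp

/-- if all weights `n − M(H)` are congruent to `m` modulo a power `Δ` of the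
characteristic `p`, then `m ≡ 0 (mod min{Δ,q})`; and if moreover `q ∣ Δ`, then the
residual weights `M(H) − M(K)` (for `K ⊆ H`, `dim K = k−2`, `H` a hyperplane) are all
congruent to `m/q` modulo `Δ/q`. -/
theorem divisible_code_residual
    (F : Type) [Field F] [Fintype F] (p e k : ℕ) (hp : p.Prime)
    (hq : Fintype.card F = p ^ e) (hk : 2 ≤ k)
    (M : ProjPoint F k → ℕ) (Δ m : ℕ) (hΔ : ∃ f : ℕ, Δ = p ^ f)
    (hcong : ∀ H : ProjHyp F k,
      msum M (⊤ : Submodule F (Fin k → F)) - msum M H.1 ≡ m [MOD Δ]) :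
    min Δ (Fintype.card F) ∣ m ∧
    (Fintype.card F ∣ Δ →
      ∀ K : Submodule F (Fin k → F), Module.finrank F K = k - 2 →
        ∀ H : ProjHyp F k, K ≤ H.1 →
          msum M H.1 - msum M K ≡ m / Fintype.card F [MOD Δ / Fintype.card F]) := by
  set q := Fintype.card F with hqdef
  have hq0 : q ≠ 0 := Fintype.card_ne_zero
  obtain ⟨f, rfl⟩ := hΔ
  have hdvd : min (p ^ f) q ∣ p ^ f ∧ min (p ^ f) q ∣ q := by
    rw [hq]
    rcases le_total f e with h | h
    · rw [min_eq_left (Nat.pow_le_pow_right hp.pos h)]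
      exact ⟨dvd_rfl, pow_dvd_pow p h⟩
    · rw [min_eq_right (Nat.pow_le_pow_right hp.pos h)]
      exact ⟨pow_dvd_pow p h, dvd_rfl⟩
  have hm : min (p ^ f) q ∣ m := by
    obtain ⟨K, hK⟩ : ∃ K : Submodule F (Fin k → F), Module.finrank F K = k - 2 := by
      obtain ⟨b, hb⟩ := exists_linearIndependent_of_le_finrank (R := F) (M := Fin k → F)
        (n := k - 2) (by simp)
      exact ⟨Submodule.span F (Set.range b), by simpa using finrank_span_eq_card hb⟩
    have h := (card_mul_msum_sub_modEq hk M hcong K hK).of_dvd hdvd.1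
    have h' := (h.dvd_iff dvd_rfl).1 (hdvd.2.mul_right _)
    rw [add_mul, one_mul] at h'
    exact (Nat.dvd_add_right (hdvd.2.mul_right m)).1 h'
  refine ⟨hm, fun hqΔ K hK H hKH ↦ ?_⟩
  rw [min_eq_right (Nat.le_of_dvd (pow_pos hp.pos f) hqΔ)] at hm
  obtain ⟨m', rfl⟩ := hm
  obtain ⟨D, hD⟩ := hqΔ
  rw [hD] at hcong ⊢
  rw [Nat.mul_div_cancel_left _ hq0.bot_lt, Nat.mul_div_cancel_left _ hq0.bot_lt]
  have hK' : msum M ⊤ - msum M K ≡ (q + 1) * m' [MOD D] := by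
    refine Nat.ModEq.mul_left_cancel' hq0 ?_
    rw [mul_left_comm q (q + 1)]
    exact card_mul_msum_sub_modEq hk M hcong K hK
  have hsplit : (msum M ⊤ - msum M H.1) + (msum M H.1 - msum M K) = msum M ⊤ - msum M K :=
    tsub_add_tsub_cancel (msum_mono M le_top) (msum_mono M hKH)
  refine Nat.ModEq.add_left_cancel ((hcong H).of_dvd (dvd_mul_left D q)) ?_
  rw [hsplit]
  simpa [add_mul] using hK'
end

section
/- (i) There is no binary linear code C ⊆ 𝔽_2^{17} of dimension at least 1 with full length (for every coordinate i there is c ∈ C with c_i ≠ 0) such that every codeword weight is divisible by 8. (ii) Every binary linear code C ⊆ 𝔽_2^{34} with full length all of whose codeword weights are divisible by 8 has column multiplicity at least two: there exist coordinates i ≠ j such that c_i = c_j for every c ∈ C. -/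
/-- The Hamming weight of a word of `𝔽_2^n`: the number of nonzero coordinates. -/
def binWeight {n : ℕ} (c : Fin n → ZMod 2) : ℕ :=
  (Finset.univ.filter (fun i => c i ≠ 0)).card

/-- The number of nonzero coordinates of `c` inside the coordinate set `T`. -/
def binWeightOn {n : ℕ} (T : Finset (Fin n)) (c : Fin n → ZMod 2) : ℕ :=
  (T.filter (fun i => c i ≠ 0)).card

lemma binWeightOn_univ {n : ℕ} (c : Fin n → ZMod 2) :
    binWeightOn Finset.univ c = binWeight c := rfl

lemma binWeightOn_eq_sum {n : ℕ} (T : Finset (Fin n)) (c : Fin n → ZMod 2) :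
    binWeightOn T c = ∑ i ∈ T, if c i ≠ 0 then 1 else 0 := by
  rw [binWeightOn, Finset.card_filter]

lemma card_filter_eq_zero_add_binWeightOn {n : ℕ} (T : Finset (Fin n)) (c : Fin n → ZMod 2) :
    (T.filter (fun i => c i = 0)).card + binWeightOn T c = T.card :=
  Finset.card_filter_add_card_filter_not _

lemma binWeightOn_add_binWeightOn_add {n : ℕ} (T : Finset (Fin n)) (c d : Fin n → ZMod 2) :
    binWeightOn T d + binWeightOn T (d + c) =
      binWeightOn T c + 2 * binWeightOn (T.filter (fun i => c i = 0)) d := by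
  simp only [binWeightOn_eq_sum, Finset.sum_filter, Finset.mul_sum, ← Finset.sum_add_distrib,
    Pi.add_apply]
  have key : ∀ x y : ZMod 2,
      ((if y ≠ 0 then 1 else 0) + if y + x ≠ 0 then 1 else 0) =
        (if x ≠ 0 then 1 else 0) + 2 * if x = 0 then if y ≠ 0 then 1 else 0 else 0 := by
    decide
  exact Finset.sum_congr rfl fun i _ => key (c i) (d i)

/-- Residual codes of `2Δ`-divisible codes are `Δ`-divisible. -/
lemma dvd_binWeightOn_residual {n : ℕ} {C : Submodule (ZMod 2) (Fin n → ZMod 2)}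
    {T : Finset (Fin n)} {Δ : ℕ} (h : ∀ d ∈ C, 2 * Δ ∣ binWeightOn T d)
    {c : Fin n → ZMod 2} (hc : c ∈ C) :
    ∀ d ∈ C, Δ ∣ binWeightOn (T.filter (fun i => c i = 0)) d := by
  intro d hd
  have h1 := dvd_add (h d hd) (h _ (C.add_mem hd hc))
  rw [binWeightOn_add_binWeightOn_add] at h1
  exact Nat.dvd_of_mul_dvd_mul_left two_pos ((Nat.dvd_add_right (h c hc)).mp h1)

/-- A nonzero coordinate functional is nonzero on exactly half of the code. -/
lemma two_mul_sum_ne_zero_eq_card {n : ℕ} (C : Submodule (ZMod 2) (Fin n → ZMod 2)) [Fintype C]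
    {i : Fin n} (hi : ∃ c ∈ C, c i ≠ 0) :
    2 * ∑ c : C, (if (c : Fin n → ZMod 2) i ≠ 0 then 1 else 0) = Fintype.card C := by
  obtain ⟨c₀, hc₀, hne⟩ := hi
  rw [two_mul]
  nth_rewrite 2 [← Equiv.sum_comp (Equiv.addRight (⟨c₀, hc₀⟩ : C))]
  rw [← Finset.sum_add_distrib, Fintype.card_eq_sum_ones]
  refine Finset.sum_congr rfl fun c _ => ?_
  simp only [Equiv.coe_addRight, Submodule.coe_add, Pi.add_apply]
  have key : ∀ x y : ZMod 2, y ≠ 0 →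
      ((if x ≠ 0 then 1 else 0) + if x + y ≠ 0 then 1 else 0) = 1 := by
    decide
  exact key _ _ hne

/-- Some codeword of a full-length code has weight at least half the length. -/
lemma exists_card_le_two_mul_binWeightOn {n : ℕ} (C : Submodule (ZMod 2) (Fin n → ZMod 2))
    (hfull : ∀ i, ∃ c ∈ C, c i ≠ 0) (T : Finset (Fin n)) :
    ∃ c ∈ C, T.card ≤ 2 * binWeightOn T c := by
  classical
  have : Fintype C := Fintype.ofFinite C
  have hsum : ∑ c : C, 2 * binWeightOn T (c : Fin n → ZMod 2) = ∑ _c : C, T.card := by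
    simp only [binWeightOn_eq_sum]
    rw [← Finset.mul_sum, Finset.sum_comm, Finset.mul_sum,
      Finset.sum_congr rfl fun i _ => two_mul_sum_ne_zero_eq_card C (hfull i)]
    simp [mul_comm]
  obtain ⟨c, -, hc⟩ := Finset.exists_le_of_sum_le Finset.univ_nonempty hsum.ge
  exact ⟨c, c.2, hc⟩

/-- If a code is even on two coordinates, then these coordinates agree on all codewords. -/
lemma exists_repeated_column_of_card_eq_two {n : ℕ} {C : Submodule (ZMod 2) (Fin n → ZMod 2)}
    {T : Finset (Fin n)} (hT : T.card = 2) (h : ∀ c ∈ C, 2 ∣ binWeightOn T c) :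
    ∃ i j : Fin n, i ≠ j ∧ ∀ c ∈ C, c i = c j := by
  obtain ⟨i, j, hij, rfl⟩ := Finset.card_eq_two.mp hT
  refine ⟨i, j, hij, fun c hc => ?_⟩
  have hdvd := h c hc
  rw [binWeightOn_eq_sum, Finset.sum_pair hij] at hdvd
  revert hdvd
  generalize c i = x
  generalize c j = y
  revert x y
  decide


/-- (i) there is no full-length `8`-divisible binary linear code of length
`17` and dimension at least `1`; (ii) every full-length `8`-divisible binary linear code of
length `34` has column multiplicity at least two, i.e. two coordinates that agree on all
codewords. -/
theorem no_eight_divisible_17_and_34_repeated_column :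
    (¬ ∃ C : Submodule (ZMod 2) (Fin 17 → ZMod 2),
        1 ≤ Module.finrank (ZMod 2) C ∧
        (∀ i : Fin 17, ∃ c ∈ C, c i ≠ 0) ∧
        (∀ c ∈ C, 8 ∣ binWeight c)) ∧
    (∀ C : Submodule (ZMod 2) (Fin 34 → ZMod 2),
        (∀ i : Fin 34, ∃ c ∈ C, c i ≠ 0) →
        (∀ c ∈ C, 8 ∣ binWeight c) →
        ∃ i j : Fin 34, i ≠ j ∧ ∀ c ∈ C, c i = c j) := by
  constructor
  · rintro ⟨C, -, hfull, hdiv⟩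
    obtain ⟨c, hc, hle⟩ := exists_card_le_two_mul_binWeightOn C hfull Finset.univ
    have hres := dvd_binWeightOn_residual (Δ := 4) hdiv hc
    have hcard := card_filter_eq_zero_add_binWeightOn Finset.univ c
    obtain ⟨k, hk⟩ := hdiv c hc
    rw [← binWeightOn_univ] at hk
    rw [Finset.card_univ, Fintype.card_fin] at hle hcard
    obtain ⟨i, hi⟩ := Finset.card_eq_one.mp
      (show (Finset.univ.filter (fun i => c i = 0)).card = 1 by omega)
    obtain ⟨d, hd, hne⟩ := hfull i
    have hdvd := hres d hd
    rw [hi, binWeightOn_eq_sum, Finset.sum_singleton, if_pos hne] at hdvd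
    omega
  · intro C hfull hdiv
    obtain ⟨c, hc, hle⟩ := exists_card_le_two_mul_binWeightOn C hfull Finset.univ
    have hres := dvd_binWeightOn_residual (Δ := 4) hdiv hc
    have hcard := card_filter_eq_zero_add_binWeightOn Finset.univ c
    obtain ⟨k, hk⟩ := hdiv c hc
    rw [← binWeightOn_univ] at hk
    rw [Finset.card_univ, Fintype.card_fin] at hle hcard
    generalize Finset.univ.filter (fun i => c i = 0) = T at hres hcard
    obtain hT | hT : T.card = 2 ∨ T.card = 10 := by omega
    · exact exists_repeated_column_of_card_eq_two hT
        fun d hd => dvd_trans (by norm_num) (hres d hd)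
    · obtain ⟨d, hd, hle'⟩ := exists_card_le_two_mul_binWeightOn C hfull T
      obtain ⟨m, hm⟩ := hres d hd
      have hcard' := card_filter_eq_zero_add_binWeightOn T d
      exact exists_repeated_column_of_card_eq_two (by omega)
        (dvd_binWeightOn_residual (Δ := 2) hres hd)
end
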